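/- For every integer m ≥ 3, Σ_{t ∈ I_m} r(t)·2^{m − o(t)} = (m + 1)·m!/6. Equivalently, the expected number of pitchforks of a coalescent-generated 0-1-2-increasing tree with m > 2 nodes is (m + 1)/6. -/

import Mathlib

/-- A 0-1-2-increasing tree of size `m`: vertices are `Fin m` (index `i`
represents label `i+1`, so index `0` is the root labelled `1`), encoded by a
parent function `f` with `f i < i` for every non-root vertex `i`
(and `f 0 = 0` by convention), such that every vertex has at most 2 children. -/
abbrev IncTree (m : ℕ) : Type :=
  {f : Fin m → Fin m //
    (∀ i : Fin m, i.val = 0 → f i = i) ∧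
    (∀ i : Fin m, i.val ≠ 0 → (f i).val < i.val) ∧
    (∀ j : Fin m, (Finset.univ.filter (fun i : Fin m => i.val ≠ 0 ∧ f i = j)).card ≤ 2)}

/-- The number of children of the vertex `j` in the tree `t`. -/
def numChildren {m : ℕ} (t : IncTree m) (j : Fin m) : ℕ :=
  (Finset.univ.filter (fun i : Fin m => i.val ≠ 0 ∧ t.val i = j)).card

/-- `o t`: the number of leaves (outdegree-0 vertices) of `t`. -/
def numLeaves {m : ℕ} (t : IncTree m) : ℕ :=
  (Finset.univ.filter (fun j : Fin m => numChildren t j = 0)).card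

/-- `r t`: the number of pitchforks of `t`, i.e. vertices with exactly one
child, that child being a leaf. -/
def numPitchforks {m : ℕ} (t : IncTree m) : ℕ :=
  (Finset.univ.filter (fun j : Fin m =>
    numChildren t j = 1 ∧
      ∀ i : Fin m, i.val ≠ 0 → t.val i = j → numChildren t i = 0)).card

theorem nc_le {m : ℕ} (t : IncTree m) (j : Fin m) : numChildren t j ≤ 2 := t.2.2.2 j

/-- raw extension -/
def extFun {m : ℕ} (f : Fin m → Fin m) (v : Fin m) : Fin (m+1) → Fin (m+1) :=
  Fin.lastCases v.castSucc (fun i => (f i).castSucc)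

@[simp] theorem extFun_last {m : ℕ} (f : Fin m → Fin m) (v : Fin m) :
    extFun f v (Fin.last m) = v.castSucc := by simp [extFun]

@[simp] theorem extFun_castSucc {m : ℕ} (f : Fin m → Fin m) (v i : Fin m) :
    extFun f v i.castSucc = (f i).castSucc := by simp [extFun]

theorem card_ext_castSucc {m : ℕ} (f : Fin m → Fin m) (v j : Fin m) :
    (Finset.univ.filter (fun i : Fin (m+1) => i.val ≠ 0 ∧ extFun f v i = j.castSucc)).card =
    (Finset.univ.filter (fun i : Fin m => i.val ≠ 0 ∧ f i = j)).card + if v = j then 1 else 0 := by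
  have hm : m ≠ 0 := by have := v.2; omega
  rw [Finset.card_filter, Finset.card_filter, Fin.sum_univ_castSucc]
  simp [hm]

theorem card_ext_last {m : ℕ} (f : Fin m → Fin m) (v : Fin m) :
    (Finset.univ.filter (fun i : Fin (m+1) => i.val ≠ 0 ∧ extFun f v i = Fin.last m)).card = 0 := by
  rw [Finset.card_filter, Fin.sum_univ_castSucc]
  simp [(Fin.castSucc_lt_last _).ne]

def extTree {m : ℕ} (t : IncTree m) (v : {v : Fin m // numChildren t v ≤ 1}) : IncTree (m+1) :=
  ⟨extFun t.1 v.1, by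
    have hm : m ≠ 0 := by have := v.1.2; omega
    refine ⟨?_, ?_, ?_⟩
    · intro i
      induction i using Fin.lastCases with
      | last => intro h; simp at h; omega
      | cast i => intro h; simpa using t.2.1 i (by simpa using h)
    · intro i
      induction i using Fin.lastCases with
      | last => intro h; simp
      | cast i => intro h; simpa using t.2.2.1 i (by simpa using h)
    · intro j
      induction j using Fin.lastCases with
      | last => rw [card_ext_last]; omega
      | cast j =>
        rw [card_ext_castSucc]
        have h1 := t.2.2.2 j
        have h2 := v.2
        unfold numChildren at h2
        split_ifs with h
        · subst h; omega
        · omega⟩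

theorem nc_ext_castSucc {m : ℕ} (t : IncTree m) (v : {v : Fin m // numChildren t v ≤ 1}) (j : Fin m) :
    numChildren (extTree t v) j.castSucc = numChildren t j + if v.1 = j then 1 else 0 :=
  card_ext_castSucc _ _ _

theorem nc_ext_last {m : ℕ} (t : IncTree m) (v : {v : Fin m // numChildren t v ≤ 1}) :
    numChildren (extTree t v) (Fin.last m) = 0 := card_ext_last _ _

theorem ext_bij {m : ℕ} (hm : m ≠ 0) : Function.Bijective
    (fun p : (t : IncTree m) × {v : Fin m // numChildren t v ≤ 1} => extTree p.1 p.2) := by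
  constructor
  · rintro ⟨t, v⟩ ⟨t', v'⟩ h
    have h : extFun t.1 v.1 = extFun t'.1 v'.1 := congrArg Subtype.val h
    have ht : t = t' := by
      apply Subtype.ext
      funext i
      simpa using congrFun h i.castSucc
    subst ht
    have hv : v = v' := by
      apply Subtype.ext
      simpa using congrFun h (Fin.last m)
    rw [hv]
  · rintro ⟨f, h0, h1, h2⟩
    have key : ∃ (g : Fin m → Fin m) (v : Fin m), extFun g v = f := by
      have hl : (f (Fin.last m)).val < m := by simpa using h1 (Fin.last m) (by simpa using hm)
      have hc : ∀ i : Fin m, (f i.castSucc).val < m := by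
        intro i
        by_cases hi : i.val = 0
        · rw [h0 i.castSucc (by simpa using hi)]; simp
        · have := h1 i.castSucc (by simpa using hi)
          simp at this
          omega
      refine ⟨fun i => ⟨_, hc i⟩, ⟨_, hl⟩, ?_⟩
      funext i
      induction i using Fin.lastCases with
      | last => simp
      | cast i => simp
    obtain ⟨g, v, rfl⟩ := key
    refine ⟨⟨⟨g, ?_, ?_, ?_⟩, ⟨v, ?_⟩⟩, ?_⟩
    · intro i hi
      simpa using h0 i.castSucc (by simpa using hi)
    · intro i hi
      simpa using h1 i.castSucc (by simpa using hi)
    · intro j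
      have := h2 j.castSucc
      rw [card_ext_castSucc] at this
      omega
    · have := h2 v.castSucc
      rw [card_ext_castSucc] at this
      simp only [if_true] at this
      unfold numChildren
      simp only
      omega
    · rfl

theorem sum_ext {m : ℕ} (hm : m ≠ 0) (F : IncTree (m+1) → ℚ) (G : IncTree m → Fin m → ℚ)
    (h : ∀ t v, F (extTree t v) = G t v.1) :
    ∑ t, F t = ∑ t : IncTree m, ∑ v : Fin m, if numChildren t v ≤ 1 then G t v else 0 := by
  rw [← (ext_bij hm).sum_comp F, Fintype.sum_sigma]
  refine Finset.sum_congr rfl fun t _ => ?_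
  rw [← Finset.sum_filter, Finset.sum_subtype (p := fun v => numChildren t v ≤ 1) _ (by simp)]
  exact Finset.sum_congr rfl fun v _ => h t v

def IsPF {m : ℕ} (t : IncTree m) (j : Fin m) : Prop :=
  numChildren t j = 1 ∧ ∀ i : Fin m, i.val ≠ 0 → t.val i = j → numChildren t i = 0

instance {m : ℕ} (t : IncTree m) (j : Fin m) : Decidable (IsPF t j) := by
  unfold IsPF; infer_instance

theorem leaves_eq {m : ℕ} (t : IncTree m) :
    (numLeaves t : ℚ) = ∑ j, if numChildren t j = 0 then (1:ℚ) else 0 := by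
  simp [numLeaves]

theorem pf_eq {m : ℕ} (t : IncTree m) :
    (numPitchforks t : ℚ) = ∑ j, if IsPF t j then (1:ℚ) else 0 := by
  simp [numPitchforks, IsPF]

theorem leaves_ext {m : ℕ} (t : IncTree m) (v : {v : Fin m // numChildren t v ≤ 1}) :
    (numLeaves (extTree t v) : ℚ) = numLeaves t + 1 - if numChildren t v.1 = 0 then 1 else 0 := by
  rw [leaves_eq, leaves_eq, Fin.sum_univ_castSucc]
  simp only [nc_ext_castSucc, nc_ext_last, if_true]
  have : ∀ j, (if numChildren t j + (if v.1 = j then 1 else 0) = 0 then (1:ℚ) else 0) =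
      (if numChildren t j = 0 then (1:ℚ) else 0) -
        if v.1 = j then (if numChildren t j = 0 then (1:ℚ) else 0) else 0 := by
    intro j; split_ifs <;> simp_all
  simp only [this, Finset.sum_sub_distrib, Finset.sum_ite_eq, Finset.mem_univ, if_true]
  ring

theorem pf_last {m : ℕ} (t : IncTree m) (v : {v : Fin m // numChildren t v ≤ 1}) :
    ¬ IsPF (extTree t v) (Fin.last m) := by
  rintro ⟨h, -⟩
  rw [nc_ext_last] at h
  omega

theorem pf_cast {m : ℕ} (t : IncTree m) (v : {v : Fin m // numChildren t v ≤ 1}) (j : Fin m) :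
    IsPF (extTree t v) j.castSucc ↔
      (numChildren t j + (if v.1 = j then 1 else 0) = 1 ∧
       ∀ i : Fin m, i.val ≠ 0 → t.1 i = j → numChildren t i = 0 ∧ v.1 ≠ i) := by
  unfold IsPF
  rw [nc_ext_castSucc]
  refine and_congr_right fun _ => ?_
  constructor
  · intro h i hi hij
    have := h i.castSucc (by simpa using hi) (by simp [extTree, hij])
    rw [nc_ext_castSucc] at this
    split_ifs at this with h'
    · omega
  · intro h i
    induction i using Fin.lastCases with
    | last => intros; exact nc_ext_last _ _
    | cast i =>
      intro hi hij
      have := h i (by simpa using hi) (by simpa [extTree] using hij)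
      rw [nc_ext_castSucc, if_neg this.2, this.1]

theorem nc_zero {m : ℕ} (t : IncTree m) (j : Fin m) (h : numChildren t j = 0) (i : Fin m)
    (hi : i.val ≠ 0) : t.1 i ≠ j := by
  intro hj
  unfold numChildren at h
  rw [Finset.card_eq_zero, Finset.filter_eq_empty_iff] at h
  exact h (Finset.mem_univ i) ⟨hi, hj⟩

/-- indicator count -/
def qq {m : ℕ} (t : IncTree m) (v : Fin m) : ℚ :=
  ∑ j, if IsPF t j ∧ v.val ≠ 0 ∧ t.1 v = j then (1:ℚ) else 0

theorem pf_ext {m : ℕ} (t : IncTree m) (v : {v : Fin m // numChildren t v ≤ 1}) :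
    (numPitchforks (extTree t v) : ℚ) = numPitchforks t +
      (if numChildren t v.1 = 0 then 1 - qq t v.1 else 0) - if IsPF t v.1 then 1 else 0 := by
  obtain ⟨v, hv⟩ := v
  rw [pf_eq, pf_eq, Fin.sum_univ_castSucc, if_neg (pf_last _ _)]
  simp only [pf_cast]
  by_cases h0 : numChildren t v = 0
  · have hP : ¬ IsPF t v := fun h => by have := h.1; omega
    rw [if_pos h0, if_neg hP, qq]
    have h1 : (1:ℚ) = ∑ j, if v = j then 1 else 0 := by simp
    rw [h1, ← Finset.sum_sub_distrib, ← Finset.sum_add_distrib, add_zero, sub_zero]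
    rw [← h1]
    refine Finset.sum_congr rfl fun j _ => ?_
    by_cases hj : v = j
    · subst hj
      rw [if_pos, if_neg hP, if_pos rfl, if_neg (fun h => hP h.1)]
      · norm_num
      · refine ⟨by simp [h0], fun i hi hij => absurd hij (nc_zero t _ h0 i hi)⟩
    · simp only [if_neg hj, add_zero, zero_sub]
      by_cases hPj : IsPF t j
      · by_cases hc : v.val ≠ 0 ∧ t.1 v = j
        · rw [if_neg, if_pos hPj, if_pos ⟨hPj, hc⟩]
          · norm_num
          · rintro ⟨-, h⟩
            exact (h v hc.1 hc.2).2 rfl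
        · rw [if_pos, if_pos hPj, if_neg (fun h => hc h.2)]
          · norm_num
          · refine ⟨hPj.1, fun i hi hij => ⟨hPj.2 i hi hij, ?_⟩⟩
            rintro rfl
            exact hc ⟨hi, hij⟩
      · rw [if_neg, if_neg hPj, if_neg (fun h => hPj h.1)]
        · norm_num
        · rintro ⟨h1, h2⟩
          exact hPj ⟨h1, fun i hi hij => (h2 i hi hij).1⟩
  · rw [if_neg h0]
    have h1 : (if IsPF t v then (1:ℚ) else 0) = ∑ j, if v = j then (if IsPF t j then (1:ℚ) else 0) else 0 := by
      simp
    rw [h1, add_zero, add_zero, ← Finset.sum_sub_distrib]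
    refine Finset.sum_congr rfl fun j _ => ?_
    by_cases hj : v = j
    · subst hj
      rw [if_neg]
      · simp
      · rintro ⟨h, -⟩
        simp at h
        omega
    · simp only [if_neg hj, add_zero, sub_zero]
      congr 1
      refine propext (and_congr_right fun _ => ?_)
      constructor
      · intro h i hi hij
        exact (h i hi hij).1
      · intro h i hi hij
        refine ⟨h i hi hij, ?_⟩
        rintro rfl
        exact h0 (h _ hi hij)

theorem sum_qq {m : ℕ} (t : IncTree m) :
    ∑ v, (if numChildren t v = 0 then qq t v else 0) = numPitchforks t := by
  have h1 : ∀ v, (if numChildren t v = 0 then qq t v else 0) =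
      ∑ j, if IsPF t j then (if v.val ≠ 0 ∧ t.1 v = j then (1:ℚ) else 0) else 0 := by
    intro v
    by_cases h : numChildren t v = 0
    · rw [if_pos h, qq]
      refine Finset.sum_congr rfl fun j _ => ?_
      split_ifs <;> tauto
    · rw [if_neg h]
      symm
      refine Finset.sum_eq_zero fun j _ => ?_
      split_ifs with h1 h2
      · exact absurd (h1.2 v h2.1 h2.2) h
      · rfl
      · rfl
  simp only [h1]
  rw [Finset.sum_comm, pf_eq]
  refine Finset.sum_congr rfl fun j _ => ?_
  split_ifs with h
  · rw [Finset.sum_boole]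
    exact_mod_cast h.1
  · simp

theorem sum_nc {m : ℕ} (hm : m ≠ 0) (t : IncTree m) : ∑ j, (numChildren t j : ℚ) = m - 1 := by
  obtain ⟨n, rfl⟩ := Nat.exists_eq_succ_of_ne_zero hm
  have h : ∀ j, (numChildren t j : ℚ) = ∑ i : Fin (n+1), if i.val ≠ 0 ∧ t.1 i = j then (1:ℚ) else 0 := by
    intro j; rw [Finset.sum_boole]; rfl
  simp only [h]
  rw [Finset.sum_comm]
  have h2 : ∀ i : Fin (n+1), (∑ j, if i.val ≠ 0 ∧ t.1 i = j then (1:ℚ) else 0) =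
      if i.val ≠ 0 then 1 else 0 := by
    intro i
    by_cases hi : i.val = 0 <;> simp [hi]
  rw [Finset.sum_congr rfl fun i _ => h2 i, Fin.sum_univ_succ]
  simp

def aa {m : ℕ} (t : IncTree m) (v : Fin m) : ℚ := if numChildren t v = 0 then 1 else 0
def bb {m : ℕ} (t : IncTree m) (v : Fin m) : ℚ := if numChildren t v = 1 then 1 else 0

theorem sum_aa {m : ℕ} (t : IncTree m) : ∑ v, aa t v = numLeaves t := (leaves_eq t).symm

theorem sum_bb {m : ℕ} (hm : m ≠ 0) (t : IncTree m) :
    ∑ v, bb t v = m + 1 - 2 * numLeaves t := by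
  have h : ∀ v, bb t v = 2 - 2 * aa t v - numChildren t v := by
    intro v
    have := nc_le t v
    unfold bb aa
    interval_cases numChildren t v <;> norm_num
  simp only [h, Finset.sum_sub_distrib, ← Finset.mul_sum, sum_aa, sum_nc hm]
  simp
  ring

theorem leaves_le {m : ℕ} (t : IncTree m) : numLeaves t ≤ m := by
  unfold numLeaves
  exact (Finset.card_filter_le _ _).trans (by simp)

def wt {m : ℕ} (t : IncTree m) : ℚ := 2 ^ (m - numLeaves t)

theorem wt_ext {m : ℕ} (t : IncTree m) (v : {v : Fin m // numChildren t v ≤ 1}) :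
    wt (extTree t v) = wt t * if numChildren t v.1 = 0 then 2 else 1 := by
  have h := leaves_ext t v
  have hl := leaves_le t
  unfold wt
  split_ifs at h ⊢ with h0
  · have : numLeaves (extTree t v) = numLeaves t := by
      have : (numLeaves (extTree t v) : ℚ) = numLeaves t := by linarith
      exact_mod_cast this
    rw [this, Nat.sub_add_comm hl, pow_succ]
  · have : numLeaves (extTree t v) = numLeaves t + 1 := by
      have : (numLeaves (extTree t v) : ℚ) = numLeaves t + 1 := by linarith
      exact_mod_cast this
    rw [this, mul_one, Nat.add_sub_add_right]

theorem rec_W {m : ℕ} (hm : m ≠ 0) :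
    ∑ t : IncTree (m+1), wt t = (m + 1) * ∑ t : IncTree m, wt t := by
  rw [sum_ext hm _ (fun t v => wt t * if numChildren t v = 0 then 2 else 1) wt_ext, Finset.mul_sum]
  refine Finset.sum_congr rfl fun t _ => ?_
  have h : ∀ v, (if numChildren t v ≤ 1 then wt t * (if numChildren t v = 0 then 2 else 1) else 0) =
      2 * wt t * aa t v + wt t * bb t v := by
    intro v
    have := nc_le t v
    unfold bb aa
    interval_cases numChildren t v <;> norm_num
    ring
  simp only [h, Finset.sum_add_distrib, ← Finset.mul_sum, sum_aa, sum_bb hm]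
  ring

theorem rec_O {m : ℕ} (hm : m ≠ 0) :
    ∑ t : IncTree (m+1), (numLeaves t : ℚ) * wt t =
      (m - 1) * ∑ t : IncTree m, (numLeaves t : ℚ) * wt t + (m + 1) * ∑ t : IncTree m, wt t := by
  rw [sum_ext hm _ (fun t v => ((numLeaves t : ℚ) + 1 - if numChildren t v = 0 then 1 else 0) *
        (wt t * (if numChildren t v = 0 then 2 else 1))) (fun t v => by rw [wt_ext, leaves_ext]), Finset.mul_sum, Finset.mul_sum,
    ← Finset.sum_add_distrib]
  refine Finset.sum_congr rfl fun t _ => ?_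
  have h : ∀ v, (if numChildren t v ≤ 1 then
      ((numLeaves t : ℚ) + 1 - if numChildren t v = 0 then 1 else 0) *
        (wt t * (if numChildren t v = 0 then 2 else 1)) else 0) =
      2 * wt t * numLeaves t * aa t v + wt t * (numLeaves t + 1) * bb t v := by
    intro v
    have := nc_le t v
    unfold bb aa
    interval_cases numChildren t v <;> norm_num <;> ring
  simp only [h, Finset.sum_add_distrib, ← Finset.mul_sum, sum_aa, sum_bb hm]
  ring

theorem rec_R {m : ℕ} (hm : m ≠ 0) :
    ∑ t : IncTree (m+1), (numPitchforks t : ℚ) * wt t =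
      (m - 2) * ∑ t : IncTree m, (numPitchforks t : ℚ) * wt t
        + 2 * ∑ t : IncTree m, (numLeaves t : ℚ) * wt t := by
  rw [sum_ext hm _ (fun t v => ((numPitchforks t : ℚ) +
      (if numChildren t v = 0 then 1 - qq t v else 0) - if IsPF t v then 1 else 0) *
        (wt t * (if numChildren t v = 0 then 2 else 1))) (fun t v => by rw [wt_ext, pf_ext]), Finset.mul_sum, Finset.mul_sum,
    ← Finset.sum_add_distrib]
  refine Finset.sum_congr rfl fun t _ => ?_
  have h : ∀ v, (if numChildren t v ≤ 1 then
      ((numPitchforks t : ℚ) + (if numChildren t v = 0 then 1 - qq t v else 0) -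
        if IsPF t v then 1 else 0) *
        (wt t * (if numChildren t v = 0 then 2 else 1)) else 0) =
      2 * wt t * (numPitchforks t + 1) * aa t v + wt t * numPitchforks t * bb t v
        - 2 * wt t * (if numChildren t v = 0 then qq t v else 0)
        - wt t * (if IsPF t v then 1 else 0) := by
    intro v
    have := nc_le t v
    have hp : IsPF t v → numChildren t v = 1 := fun h => h.1
    unfold bb aa
    by_cases hP : IsPF t v
    · simp [hP, hp hP]; ring
    · simp only [hP, if_false]
      interval_cases numChildren t v <;> norm_num <;> ring
  simp only [h, Finset.sum_add_distrib, Finset.sum_sub_distrib, ← Finset.mul_sum, sum_aa,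
    sum_bb hm, sum_qq, ← pf_eq]
  ring

theorem W_one : ∑ t : IncTree 1, wt t = 1 := by
  have hu : ∀ t : IncTree 1, wt t = 1 := by
    intro t
    have : numLeaves t = 1 := by
      have h := sum_nc (by norm_num) t
      have h2 := leaves_eq t
      rw [Fin.sum_univ_one] at h h2
      rw [if_pos (by simpa using h)] at h2
      exact_mod_cast h2
    simp [wt, this]
  have : Fintype.card (IncTree 1) = 1 := by decide
  simp [hu, this]

theorem W_val (m : ℕ) : ∑ t : IncTree (m+1), wt t = (m+1).factorial := by
  induction m with
  | zero => simpa using W_one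
  | succ k ih =>
    rw [rec_W (by omega), ih, Nat.factorial_succ (k+1)]
    push_cast; ring

theorem O_val (m : ℕ) : ∑ t : IncTree (m+2), (numLeaves t : ℚ) * wt t =
    (m + 3) * (m+2).factorial / 3 := by
  induction m with
  | zero =>
    rw [rec_O (m := 1) (by omega), W_val 0]
    norm_num [Nat.factorial]
  | succ k ih =>
    rw [rec_O (by omega), ih, W_val (k+1), Nat.factorial_succ (k+2)]
    push_cast; ring

theorem R_val (m : ℕ) : ∑ t : IncTree (m+3), (numPitchforks t : ℚ) * wt t =
    (m + 4) * (m+3).factorial / 6 := by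
  induction m with
  | zero =>
    rw [rec_R (m := 2) (by omega), O_val 0]
    norm_num [Nat.factorial]
  | succ k ih =>
    rw [rec_R (by omega), ih, O_val (k+1), Nat.factorial_succ (k+3)]
    push_cast; ring

theorem expected_pitchforks (m : ℕ) (hm : 3 ≤ m) :
    ∑ t : IncTree m, (numPitchforks t : ℚ) * 2 ^ (m - numLeaves t) =
      ((m : ℚ) + 1) * (Nat.factorial m) / 6 := by
  obtain ⟨k, rfl⟩ := Nat.exists_eq_add_of_le' hm
  have h := R_val k
  unfold wt at h
  rw [h]
  push_cast; ring
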